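/- Let a < b be reals and let ψ : [0,∞) → ℝ be right-continuous with left limits. Then there exists exactly one triple (φ, η₁, η₂) of functions [0,∞) → ℝ such that: φ = ψ + η₁ − η₂; φ(t) ∈ [a,b] for all t ≥ 0; η₁ and η₂ are nonnegative, nondecreasing and right-continuous, with Lebesgue–Stieltjes measures μ_{η_i} normalized so that μ_{η_i}([0,t]) = η_i(t) (so that a positive value η_i(0) is regarded as a jump at 0); and the complementarity conditions ∫_{[0,∞)} 1_{{φ(t) > a}} μ_{η₁}(dt) = 0 and ∫_{[0,∞)} 1_{{φ(t) < b}} μ_{η₂}(dt) = 0 hold. -/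

import Mathlib

open MeasureTheory

/-- `(φ,η₁,η₂)` solves the two-sided Skorohod problem on `[a,b]` for the input `ψ`
(all processes considered on the time domain `[0,∞)`): `φ = ψ + η₁ − η₂`, `φ ∈ [a,b]`,
`η₁,η₂` are nonnegative, nondecreasing and right-continuous, and the Lebesgue–Stieltjes
measures of `η₁,η₂` (normalized so that `μ([0,t]) = η(t)`, a positive value at `0` being a
jump at `0`) do not charge `{φ > a}` and `{φ < b}` respectively. -/
def IsSkorohodSolution (a b : ℝ) (ψ φ η₁ η₂ : ℝ → ℝ) : Prop :=
  (∀ t : ℝ, 0 ≤ t → φ t = ψ t + η₁ t - η₂ t) ∧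
  (∀ t : ℝ, 0 ≤ t → φ t ∈ Set.Icc a b) ∧
  (∀ t : ℝ, 0 ≤ t → 0 ≤ η₁ t) ∧
  (∀ t : ℝ, 0 ≤ t → 0 ≤ η₂ t) ∧
  MonotoneOn η₁ (Set.Ici 0) ∧
  MonotoneOn η₂ (Set.Ici 0) ∧
  (∀ t : ℝ, 0 ≤ t → ContinuousWithinAt η₁ (Set.Ici t) t) ∧
  (∀ t : ℝ, 0 ≤ t → ContinuousWithinAt η₂ (Set.Ici t) t) ∧
  (∀ μ : Measure ℝ, μ (Set.Iio 0) = 0 →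
    (∀ t : ℝ, 0 ≤ t → μ (Set.Icc 0 t) = ENNReal.ofReal (η₁ t)) →
    μ {t : ℝ | a < φ t} = 0) ∧
  (∀ μ : Measure ℝ, μ (Set.Iio 0) = 0 →
    (∀ t : ℝ, 0 ≤ t → μ (Set.Icc 0 t) = ENNReal.ofReal (η₂ t)) →
    μ {t : ℝ | φ t < b} = 0)

open Set Filter Topology

/-- `η` is the boundary term at the lower barrier `a` for the input `ψ - ζ`, that is,
`η t = max 0 (sup_{s ≤ t} (a - ψ s + ζ s))`. -/
structure IsReflectionTerm (a : ℝ) (ψ ζ η : ℝ → ℝ) : Prop where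
  nonneg : ∀ t, 0 ≤ t → 0 ≤ η t
  le : ∀ s t, 0 ≤ s → s ≤ t → a - ψ s + ζ s ≤ η t
  exists_lt : ∀ t c, 0 ≤ t → 0 ≤ c → c < η t → ∃ s, 0 ≤ s ∧ s ≤ t ∧ c < a - ψ s + ζ s

/-- `α` and `β` are nonnegative, nondecreasing and bounded on `D`, and `ψ + α - β` stays in
`[a,b]` on `D`. -/
structure IsConfining (a b : ℝ) (ψ : ℝ → ℝ) (D : Set ℝ) (α β : ℝ → ℝ) : Prop where
  nonneg_left : ∀ t ∈ D, 0 ≤ α t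
  nonneg_right : ∀ t ∈ D, 0 ≤ β t
  mono_left : MonotoneOn α D
  mono_right : MonotoneOn β D
  lower : ∀ t ∈ D, a ≤ ψ t + α t - β t
  upper : ∀ t ∈ D, ψ t + α t - β t ≤ b
  bound : ∃ C, ∀ t ∈ D, α t ≤ C ∧ β t ≤ C

namespace IsReflectionTerm

variable {a b : ℝ} {ψ ζ η : ℝ → ℝ}

theorem mono (h : IsReflectionTerm a ψ ζ η) {s t : ℝ} (hs : 0 ≤ s) (hst : s ≤ t) :
    η s ≤ η t := by
  by_contra! hlt
  obtain ⟨r, hr, hrs, hr'⟩ := h.exists_lt s (η t) hs (h.nonneg t (hs.trans hst)) hlt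
  exact absurd (h.le r t hr (hrs.trans hst)) (not_le.2 hr')

theorem le_max (h : IsReflectionTerm a ψ ζ η) {t u ε : ℝ} (ht : 0 ≤ t) (htu : t ≤ u)
    (hζ : ∀ v, t ≤ v → v ≤ u → ζ v ≤ ζ u) (hψ : ∀ v, t ≤ v → v ≤ u → ψ t - ε ≤ ψ v) :
    η u ≤ max (η t) (a - ψ t + ε + ζ u) := by
  by_contra! hlt
  obtain ⟨s, hs, hsu, hs'⟩ := h.exists_lt u _ (ht.trans htu)
    ((h.nonneg t ht).trans (le_max_left _ _)) hlt
  rcases le_total s t with hst | hts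
  · linarith [h.le s t hs hst, le_max_left (η t) (a - ψ t + ε + ζ u)]
  · linarith [hζ s hts hsu, hψ s hts hsu, le_max_right (η t) (a - ψ t + ε + ζ u)]

theorem add_le (h₁ : IsReflectionTerm a ψ ζ η)
    (h₂ : IsReflectionTerm (-b) (-ψ) η ζ) {t u ε : ℝ} (ht : 0 ≤ t) (htu : t ≤ u)
    (hε : 0 ≤ ε) (hεab : 2 * ε < b - a) (hψ : ∀ v, t ≤ v → v ≤ u → |ψ v - ψ t| ≤ ε) :
    η u ≤ η t + ε ∧ ζ u ≤ ζ t + ε := by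
  have e₁ := h₁.le_max (ε := ε) ht htu (fun v hv hvu => h₂.mono (ht.trans hv) hvu)
    (fun v hv hvu => by linarith [(abs_le.1 (hψ v hv hvu)).1])
  have e₂ := h₂.le_max (ε := ε) ht htu (fun v hv hvu => h₁.mono (ht.trans hv) hvu)
    (fun v hv hvu => by simp only [Pi.neg_apply]; linarith [(abs_le.1 (hψ v hv hvu)).2])
  have e₃ := h₁.le t t ht le_rfl
  have e₄ := h₂.le t t ht le_rfl
  simp only [Pi.neg_apply] at e₂ e₄
  rcases le_max_iff.1 e₁ with e₁ | e₁ <;> rcases le_max_iff.1 e₂ with e₂ | e₂ <;>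
    constructor <;> linarith

theorem rightContinuous (hab : a < b) (h₁ : IsReflectionTerm a ψ ζ η)
    (h₂ : IsReflectionTerm (-b) (-ψ) η ζ) {t : ℝ} (ht : 0 ≤ t)
    (hψ : ContinuousWithinAt ψ (Ici t) t) :
    ContinuousWithinAt η (Ici t) t ∧ ContinuousWithinAt ζ (Ici t) t := by
  have key : ∀ ε > 0, ∃ δ > 0, ∀ u ∈ Ici t, dist u t < δ →
      dist (η u) (η t) < ε ∧ dist (ζ u) (ζ t) < ε := by
    intro ε hε
    have hm : 0 < min (ε / 2) ((b - a) / 4) := lt_min (by linarith) (by linarith)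
    obtain ⟨δ, hδ, H⟩ := Metric.continuousWithinAt_iff.1 hψ _ hm
    refine ⟨δ, hδ, fun u hu hut => ?_⟩
    rw [mem_Ici] at hu
    rw [Real.dist_eq, abs_of_nonneg (by linarith)] at hut
    have := h₁.add_le h₂ ht hu hm.le
      (by linarith [min_le_right (ε / 2) ((b - a) / 4)])
      (fun v hv hvu => (H (mem_Ici.2 hv)
        (by rw [Real.dist_eq, abs_of_nonneg (by linarith)]; linarith)).le)
    have m₁ := h₁.mono ht hu
    have m₂ := h₂.mono ht hu
    have := min_le_left (ε / 2) ((b - a) / 4)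
    rw [Real.dist_eq, Real.dist_eq, abs_of_nonneg (by linarith), abs_of_nonneg (by linarith)]
    constructor <;> linarith
  constructor <;> refine Metric.continuousWithinAt_iff.2 fun ε hε => ?_ <;>
    obtain ⟨δ, hδ, H⟩ := key ε hε
  · exact ⟨δ, hδ, fun u hu hut => (H u hu hut).1⟩
  · exact ⟨δ, hδ, fun u hu hut => (H u hu hut).2⟩

end IsReflectionTerm

theorem measure_setOf_Icc_null (μ : Measure ℝ) (q : ℝ) :
    μ {t : ℝ | 0 ≤ t ∧ t ≤ q ∧ μ (Icc t q) = 0} = 0 := by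
  set S : Set ℝ := {t : ℝ | 0 ≤ t ∧ t ≤ q ∧ μ (Icc t q) = 0}
  rcases S.eq_empty_or_nonempty with h | h
  · simp [h]
  have hb : BddBelow S := ⟨0, fun t ht => ht.1⟩
  by_cases hi : sInf S ∈ S
  · exact measure_mono_null (t := Icc (sInf S) q) (fun t ht => ⟨csInf_le hb ht, ht.2.1⟩) hi.2.2
  obtain ⟨u, -, hu, huS⟩ := exists_seq_tendsto_sInf h hb
  refine measure_mono_null (t := ⋃ n, Icc (u n) q) (fun t ht => ?_)
    (measure_iUnion_null fun n => (huS n).2.2)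
  have hlt : sInf S < t := lt_of_le_of_ne (csInf_le hb ht) (fun e => hi (e ▸ ht))
  obtain ⟨n, hn⟩ := (hu.eventually (gt_mem_nhds hlt)).exists
  exact mem_iUnion.2 ⟨n, hn.le, ht.2.1⟩

theorem IsReflectionTerm.measure_eq_zero {a : ℝ} {ψ ζ η φ : ℝ → ℝ}
    (h : IsReflectionTerm a ψ ζ η) (hφ : ∀ t, 0 ≤ t → φ t = ψ t + η t - ζ t)
    (hrc : ∀ t, 0 ≤ t → ContinuousWithinAt φ (Ici t) t) (μ : Measure ℝ)
    (hμ0 : μ (Iio 0) = 0) (hμ : ∀ t, 0 ≤ t → μ (Icc 0 t) = ENNReal.ofReal (η t)) :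
    μ {t | a < φ t} = 0 := by
  refine measure_mono_null
    (t := Iio 0 ∪ ⋃ q : ℚ, {t : ℝ | 0 ≤ t ∧ t ≤ q ∧ μ (Icc t (q : ℝ)) = 0}) (fun t ht => ?_)
    (measure_union_null hμ0 (measure_iUnion_null fun q => measure_setOf_Icc_null μ q))
  replace ht : a < φ t := ht
  rcases lt_or_ge t 0 with h0 | h0
  · exact Or.inl h0
  refine Or.inr ?_
  obtain ⟨δ, hδ, H⟩ := Metric.continuousWithinAt_iff.1 (hrc t h0) ((φ t - a) / 2) (by linarith)
  obtain ⟨q, hq, hq'⟩ := exists_rat_btwn (show t < t + δ by linarith)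
  have hφt : ∀ s, t ≤ s → s ≤ q → a + (φ t - a) / 2 < φ s := by
    intro s hs hsq
    have := H (mem_Ici.2 hs) (by rw [Real.dist_eq, abs_of_nonneg (by linarith)]; linarith)
    rw [Real.dist_eq] at this
    linarith [(abs_lt.1 this).1]
  refine mem_iUnion.2 ⟨q, h0, hq.le, ?_⟩
  have hq0 : (0 : ℝ) ≤ q := h0.trans hq.le
  rcases (h.nonneg q hq0).eq_or_lt with hz | hpos
  · refine measure_mono_null (Icc_subset_Icc_left h0) ?_
    rw [hμ q hq0, ← hz, ENNReal.ofReal_zero]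
  refine le_antisymm (ENNReal.le_of_forall_pos_le_add fun ε hε _ => ?_) zero_le
  set r : ℝ := min ε ((φ t - a) / 2)
  have hr0 : 0 < r := lt_min hε (by linarith)
  obtain ⟨s, hs, hsq, hs'⟩ := h.exists_lt q (max 0 (η q - r)) hq0 (le_max_left _ _)
    (max_lt hpos (by linarith))
  have h1 := (le_max_right 0 (η q - r)).trans_lt hs'
  have hst : s < t := by
    by_contra! hts
    have h2 := hφt s hts hsq
    rw [hφ s hs] at h2
    linarith [h.mono hs hsq, min_le_right (ε : ℝ) ((φ t - a) / 2)]
  have hη : η q ≤ ε + η s := by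
    linarith [h.le s s hs le_rfl, min_le_left (ε : ℝ) ((φ t - a) / 2)]
  have hsum : μ (Icc t q) + μ (Icc 0 s) ≤ μ (Icc 0 q) := by
    rw [← measure_union _ measurableSet_Icc]
    · exact measure_mono (union_subset (Icc_subset_Icc_left h0) (Icc_subset_Icc_right hsq))
    · exact disjoint_left.2 fun x hx hx' => absurd (hx.1.trans hx'.2) (not_le.2 hst)
  rw [hμ s hs, hμ q hq0] at hsum
  have h3 := hsum.trans (ENNReal.ofReal_le_ofReal hη)
  rw [ENNReal.ofReal_add ε.coe_nonneg (h.nonneg s hs), ENNReal.ofReal_coe_nnreal] at h3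
  simpa using (ENNReal.add_le_add_iff_right ENNReal.ofReal_ne_top).1 h3

/-- The Stieltjes function extending `η` by zero to the negative half-line. -/
noncomputable def stieltjesOfMonotoneOn (η : ℝ → ℝ) (h0 : ∀ t, 0 ≤ t → 0 ≤ η t)
    (hm : MonotoneOn η (Ici 0)) (hrc : ∀ t, 0 ≤ t → ContinuousWithinAt η (Ici t) t) :
    StieltjesFunction ℝ where
  toFun t := if t < 0 then 0 else η t
  mono' := by
    intro s t hst
    dsimp only
    split_ifs with hs ht ht
    · exact le_rfl
    · exact h0 t (not_lt.1 ht)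
    · exact absurd (hst.trans_lt ht) hs
    · exact hm (not_lt.1 hs) (not_lt.1 ht) hst
  right_continuous' := by
    intro t
    rcases lt_or_ge t 0 with ht | ht
    · refine (continuousWithinAt_const (b := (0 : ℝ))).congr_of_eventuallyEq ?_ (if_pos ht)
      filter_upwards [mem_nhdsWithin_of_mem_nhds (Iio_mem_nhds ht)] with u hu
      exact if_pos hu
    · refine (hrc t ht).congr (fun u hu => if_neg ?_) (if_neg (not_lt.2 ht))
      exact not_lt.2 (ht.trans hu)

theorem isReflectionTerm_of_measure {a : ℝ} {ψ ζ η φ : ℝ → ℝ}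
    (hφ : ∀ t, 0 ≤ t → φ t = ψ t + η t - ζ t) (ha : ∀ t, 0 ≤ t → a ≤ φ t)
    (h0 : ∀ t, 0 ≤ t → 0 ≤ η t) (hm : MonotoneOn η (Ici 0))
    (hrc : ∀ t, 0 ≤ t → ContinuousWithinAt η (Ici t) t)
    (hμ : ∀ μ : Measure ℝ, μ (Iio 0) = 0 →
      (∀ t : ℝ, 0 ≤ t → μ (Icc 0 t) = ENNReal.ofReal (η t)) → μ {t : ℝ | a < φ t} = 0) :
    IsReflectionTerm a ψ ζ η := by
  refine ⟨h0, fun s t hs hst => ?_, fun t c ht hc hct => ?_⟩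
  · linarith [ha s hs, hφ s hs, hm hs (hs.trans hst) hst]
  set f := stieltjesOfMonotoneOn η h0 hm hrc
  have fneg : ∀ u, u < 0 → f u = 0 := fun u hu => if_pos hu
  have fpos : ∀ u, 0 ≤ u → f u = η u := fun u hu => if_neg (not_lt.2 hu)
  have hlim : Function.leftLim f 0 = 0 := by
    refine tendsto_nhds_unique (f.mono.tendsto_leftLim 0) (tendsto_const_nhds.congr' ?_)
    filter_upwards [self_mem_nhdsWithin] with u hu using (fneg u hu).symm
  have hnull : f.measure {t : ℝ | a < φ t} = 0 := by
    refine hμ _ ?_ fun u hu => ?_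
    · have hbot : Tendsto f atBot (𝓝 0) := by
        refine tendsto_const_nhds.congr' ?_
        filter_upwards [eventually_lt_atBot (0 : ℝ)] with u hu using (fneg u hu).symm
      rw [f.measure_Iio hbot, hlim]
      simp
    · rw [f.measure_Icc, hlim, fpos u hu, sub_zero]
  by_contra! hcon
  set U : Set ℝ := {u | 0 ≤ u ∧ c < η u}
  have hUφ : ∀ u, 0 ≤ u → u ≤ t → c < η u → a < φ u := fun u hu hut hcu => by
    linarith [hcon u hu hut, hφ u hu]
  have hUb : BddBelow U := ⟨0, fun u hu => hu.1⟩
  have hUt : t ∈ U := ⟨ht, hct⟩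
  have hσ0 : 0 ≤ sInf U := le_csInf ⟨t, hUt⟩ fun u hu => hu.1
  have hlarge : ∀ u, sInf U < u → c < η u := fun u hu => by
    obtain ⟨v, hv, hvu⟩ := exists_lt_of_csInf_lt ⟨t, hUt⟩ hu
    exact hv.2.trans_le (hm hv.1 (hv.1.trans hvu.le) hvu.le)
  rcases lt_or_ge c (η (sInf U)) with hcσ | hcσ
  · have hsub : Icc (sInf U) t ⊆ {t : ℝ | a < φ t} := fun u hu =>
      hUφ u (hσ0.trans hu.1) hu.2 (hcσ.trans_le (hm hσ0 (hσ0.trans hu.1) hu.1))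
    have hz := measure_mono_null hsub hnull
    rw [f.measure_Icc, ENNReal.ofReal_eq_zero, fpos t ht] at hz
    have hle : Function.leftLim f (sInf U) ≤ c := by
      refine le_of_tendsto (f.mono.tendsto_leftLim _) ?_
      filter_upwards [self_mem_nhdsWithin] with u hu
      rcases lt_or_ge u 0 with hu0 | hu0
      · rw [fneg u hu0]; exact hc
      · rw [fpos u hu0]
        by_contra! hlt
        exact absurd (csInf_le hUb ⟨hu0, hlt⟩) (not_le.2 hu)
    linarith
  · have hsub : Ioc (sInf U) t ⊆ {t : ℝ | a < φ t} := fun u hu =>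
      hUφ u (hσ0.trans hu.1.le) hu.2 (hlarge u hu.1)
    have hz := measure_mono_null hsub hnull
    rw [f.measure_Ioc, ENNReal.ofReal_eq_zero, fpos t ht, fpos _ hσ0] at hz
    linarith

theorem isSkorohodSolution_iff {a b : ℝ} (hab : a < b) {ψ φ η₁ η₂ : ℝ → ℝ}
    (hψ : ∀ t : ℝ, 0 ≤ t → ContinuousWithinAt ψ (Ici t) t) :
    IsSkorohodSolution a b ψ φ η₁ η₂ ↔ (∀ t, 0 ≤ t → φ t = ψ t + η₁ t - η₂ t) ∧
      IsReflectionTerm a ψ η₂ η₁ ∧ IsReflectionTerm (-b) (-ψ) η₁ η₂ := by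
  have hset : {t : ℝ | φ t < b} = {t | -b < (-φ) t} := by
    ext t; simp
  constructor
  · rintro ⟨hφ, hI, p₁, p₂, m₁, m₂, c₁, c₂, n₁, n₂⟩
    rw [hset] at n₂
    exact ⟨hφ, isReflectionTerm_of_measure hφ (fun t ht => (hI t ht).1) p₁ m₁ c₁ n₁,
      isReflectionTerm_of_measure (φ := -φ)
        (fun t ht => by simp only [Pi.neg_apply]; linarith [hφ t ht])
        (fun t ht => by simpa using (hI t ht).2) p₂ m₂ c₂ n₂⟩
  · rintro ⟨hφ, h₁, h₂⟩
    have hc := fun t ht => h₁.rightContinuous hab h₂ ht (hψ t ht)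
    have hφc : ∀ t, 0 ≤ t → ContinuousWithinAt φ (Ici t) t := fun t ht =>
      (((hψ t ht).add (hc t ht).1).sub (hc t ht).2).congr
        (fun u hu => hφ u (ht.trans hu)) (hφ t ht)
    refine ⟨hφ, fun t ht => ⟨?_, ?_⟩, h₁.nonneg, h₂.nonneg,
      fun s hs t _ hst => h₁.mono hs hst, fun s hs t _ hst => h₂.mono hs hst,
      fun t ht => (hc t ht).1, fun t ht => (hc t ht).2,
      h₁.measure_eq_zero hφ hφc, ?_⟩
    · linarith [h₁.le t t ht le_rfl, hφ t ht]
    · have := h₂.le t t ht le_rfl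
      simp only [Pi.neg_apply] at this
      linarith [hφ t ht]
    · rw [hset]
      exact h₂.measure_eq_zero
        (fun t ht => by simp only [Pi.neg_apply]; linarith [hφ t ht]) fun t ht => (hφc t ht).neg

namespace IsConfining

variable {a b : ℝ} {ψ : ℝ → ℝ}

theorem subset {D E : Set ℝ} {α β : ℝ → ℝ} (h : IsConfining a b ψ D α β) (hE : E ⊆ D) :
    IsConfining a b ψ E α β where
  nonneg_left t ht := h.nonneg_left t (hE ht)
  nonneg_right t ht := h.nonneg_right t (hE ht)
  mono_left := h.mono_left.mono hE
  mono_right := h.mono_right.mono hE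
  lower t ht := h.lower t (hE ht)
  upper t ht := h.upper t (hE ht)
  bound := h.bound.imp fun _ hC t ht => hC t (hE ht)

theorem exists_union {D E : Set ℝ} (hDE : ∀ s ∈ D, ∀ t ∈ E, s < t) {c : ℝ}
    (hc : ∀ t ∈ E, |ψ t - c| ≤ (b - a) / 2) (h : ∃ α β, IsConfining a b ψ D α β) :
    ∃ α β, IsConfining a b ψ (D ∪ E) α β := by
  classical
  obtain ⟨α, β, h⟩ := h
  obtain ⟨C₀, hC₀⟩ := h.bound
  obtain ⟨C, hC0, hC⟩ : ∃ C, 0 ≤ C ∧ ∀ t ∈ D, α t ≤ C ∧ β t ≤ C :=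
    ⟨max C₀ 0, le_max_right _ _, fun t ht =>
      ⟨(hC₀ t ht).1.trans (le_max_left _ _), (hC₀ t ht).2.trans (le_max_left _ _)⟩⟩
  set p : ℝ := C + |(a + b) / 2 - c| + ((a + b) / 2 - c) with hp
  set q : ℝ := C + |(a + b) / 2 - c| with hq
  have hCp : C ≤ p := by linarith [neg_abs_le ((a + b) / 2 - c)]
  have hCq : C ≤ q := by linarith [abs_nonneg ((a + b) / 2 - c)]
  have hmono : ∀ (γ : ℝ → ℝ) (r : ℝ), MonotoneOn γ D → (∀ t ∈ D, γ t ≤ r) →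
      MonotoneOn (fun t => if t ∈ D then γ t else r) (D ∪ E) := by
    intro γ r hγ hr s hs t ht hst
    dsimp only
    split_ifs with h1 h2 h2
    · exact hγ h1 h2 hst
    · exact hr s h1
    · exact absurd (hDE t h2 s (hs.resolve_left h1)) (not_lt.2 hst)
    · exact le_rfl
  have hval : ∀ t ∈ D ∪ E, t ∉ D → a ≤ ψ t + p - q ∧ ψ t + p - q ≤ b := by
    intro t ht htD
    have := abs_le.1 (hc t (ht.resolve_left htD))
    constructor <;> linarith [this.1, this.2]
  refine ⟨fun t => if t ∈ D then α t else p, fun t => if t ∈ D then β t else q,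
    fun t ht => ?_, fun t ht => ?_, hmono α p h.mono_left fun t ht => (hC t ht).1.trans hCp,
    hmono β q h.mono_right fun t ht => (hC t ht).2.trans hCq, fun t ht => ?_, fun t ht => ?_,
    max p q, fun t ht => ?_⟩
  · split_ifs with h1
    exacts [h.nonneg_left t h1, hC0.trans hCp]
  · split_ifs with h1
    exacts [h.nonneg_right t h1, hC0.trans hCq]
  · split_ifs with h1
    exacts [h.lower t h1, (hval t ht h1).1]
  · split_ifs with h1
    exacts [h.upper t h1, (hval t ht h1).2]
  · split_ifs with h1
    · exact ⟨(hC t h1).1.trans (hCp.trans (le_max_left _ _)),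
        (hC t h1).2.trans (hCp.trans (le_max_left _ _))⟩
    · exact ⟨le_max_left _ _, le_max_right _ _⟩

theorem exists_Icc (hab : a < b) (hψrc : ∀ t : ℝ, 0 ≤ t → ContinuousWithinAt ψ (Ici t) t)
    (hψll : ∀ t : ℝ, 0 < t → ∃ c : ℝ, Tendsto ψ (𝓝[<] t) (𝓝 c)) (T : ℝ) :
    ∃ α β, IsConfining a b ψ (Icc 0 T) α β := by
  have hε : 0 < (b - a) / 2 := by linarith
  have point : ∀ D t, (∀ s ∈ D, s < t) → (∃ α β, IsConfining a b ψ D α β) →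
      ∃ α β, IsConfining a b ψ (D ∪ {t}) α β := fun D t hD h =>
    exists_union (c := ψ t) (by simpa using hD) (by simpa using hε.le) h
  by_contra hT
  have hempty : ∃ α β, IsConfining a b ψ ∅ α β :=
    ⟨0, 0, by simp, by simp, fun _ h => h.elim, fun _ h => h.elim, by simp, by simp, 0, by simp⟩
  set K : Set ℝ := {t | 0 ≤ t ∧ ∃ α β, IsConfining a b ψ (Icc 0 t) α β}
  have hK0 : (0 : ℝ) ∈ K := by
    refine ⟨le_rfl, ?_⟩
    simpa using point ∅ 0 (by simp) hempty
  have hKT : ∀ t ∈ K, t < T := by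
    intro t ht
    by_contra! hTt
    obtain ⟨α, β, h⟩ := ht.2
    exact hT ⟨α, β, h.subset (Icc_subset_Icc_right hTt)⟩
  have hKb : BddAbove K := ⟨T, fun t ht => (hKT t ht).le⟩
  have hσ0 : 0 ≤ sSup K := le_csSup hKb hK0
  have hσK : sSup K ∈ K := by
    by_contra hσ
    have hσpos : 0 < sSup K := lt_of_le_of_ne hσ0 fun e => hσ (e ▸ hK0)
    obtain ⟨c, hc⟩ := hψll _ hσpos
    have hev := hc.eventually (Metric.closedBall_mem_nhds c hε)
    obtain ⟨l, hl, hlc⟩ := (mem_nhdsLT_iff_exists_Ioo_subset' hσpos).1 hev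
    obtain ⟨s, hs, hls⟩ := exists_lt_of_lt_csSup ⟨0, hK0⟩ hl
    have hsσ : s < sSup K := lt_of_le_of_ne (le_csSup hKb hs) fun e => hσ (e ▸ hs)
    have h1 := exists_union (E := Ioo s (sSup K)) (c := c)
      (fun u hu v hv => hu.2.trans_lt hv.1)
      (fun u hu => by simpa [Real.dist_eq] using hlc ⟨hls.trans hu.1, hu.2⟩) hs.2
    rw [Icc_union_Ioo_eq_Ico hs.1 hsσ] at h1
    have h2 := point _ (sSup K) (fun u hu => hu.2) h1
    rw [Ico_union_right hσ0] at h2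
    exact hσ ⟨hσ0, h2⟩
  obtain ⟨δ, hδ, H⟩ := Metric.continuousWithinAt_iff.1 (hψrc _ hσ0) _ hε
  have h1 := exists_union (E := Ioc (sSup K) (sSup K + δ / 2)) (c := ψ (sSup K))
    (fun u hu v hv => hu.2.trans_lt hv.1)
    (fun u hu => (H (mem_Ici.2 hu.1.le) (by
      rw [Real.dist_eq, abs_of_nonneg (by linarith [hu.1])]; linarith [hu.2])).le) hσK.2
  rw [Icc_union_Ioc_eq_Icc hσ0 (by linarith)] at h1
  linarith [le_csSup hKb (show sSup K + δ / 2 ∈ K from ⟨by linarith, h1⟩)]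

end IsConfining

/-- The least monotone pair keeping `ψ` in `[a,b]` consists of the two boundary terms. -/
theorem exists_isReflectionTerm {a b : ℝ} {ψ : ℝ → ℝ}
    (hne : ∀ T, ∃ α β, IsConfining a b ψ (Icc 0 T) α β) :
    ∃ η₁ η₂ : ℝ → ℝ, IsReflectionTerm a ψ η₂ η₁ ∧ IsReflectionTerm (-b) (-ψ) η₁ η₂ := by
  set S₁ : ℝ → Set ℝ := fun t => {x | ∃ α β, IsConfining a b ψ (Icc 0 t) α β ∧ α t = x}
  set S₂ : ℝ → Set ℝ := fun t => {x | ∃ α β, IsConfining a b ψ (Icc 0 t) α β ∧ β t = x}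
  set η₁ : ℝ → ℝ := fun t => sInf (S₁ t)
  set η₂ : ℝ → ℝ := fun t => sInf (S₂ t)
  have hleast : ∀ T α β, 0 ≤ T → IsConfining a b ψ (Icc 0 T) α β →
      η₁ T ≤ α T ∧ η₂ T ≤ β T := fun T α β hT h =>
    ⟨csInf_le ⟨0, by rintro x ⟨α, β, h, rfl⟩; exact h.nonneg_left T ⟨hT, le_rfl⟩⟩ ⟨α, β, h, rfl⟩,
      csInf_le ⟨0, by rintro x ⟨α, β, h, rfl⟩; exact h.nonneg_right T ⟨hT, le_rfl⟩⟩
        ⟨α, β, h, rfl⟩⟩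
  have hge₁ : ∀ t x, (∀ α β, IsConfining a b ψ (Icc 0 t) α β → x ≤ α t) → x ≤ η₁ t := by
    intro t x hx
    obtain ⟨α, β, h⟩ := hne t
    refine le_csInf ⟨_, α, β, h, rfl⟩ ?_
    rintro y ⟨α, β, h, rfl⟩
    exact hx α β h
  have hge₂ : ∀ t x, (∀ α β, IsConfining a b ψ (Icc 0 t) α β → x ≤ β t) → x ≤ η₂ t := by
    intro t x hx
    obtain ⟨α, β, h⟩ := hne t
    refine le_csInf ⟨_, α, β, h, rfl⟩ ?_
    rintro y ⟨α, β, h, rfl⟩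
    exact hx α β h
  have p₁ : ∀ t, 0 ≤ t → 0 ≤ η₁ t := fun t ht =>
    hge₁ t 0 fun α β h => h.nonneg_left t ⟨ht, le_rfl⟩
  have p₂ : ∀ t, 0 ≤ t → 0 ≤ η₂ t := fun t ht =>
    hge₂ t 0 fun α β h => h.nonneg_right t ⟨ht, le_rfl⟩
  have m₁ : ∀ s t, 0 ≤ s → s ≤ t → η₁ s ≤ η₁ t := fun s t hs hst =>
    hge₁ t _ fun α β h => (hleast s α β hs (h.subset (Icc_subset_Icc_right hst))).1.trans
      (h.mono_left ⟨hs, hst⟩ ⟨hs.trans hst, le_rfl⟩ hst)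
  have m₂ : ∀ s t, 0 ≤ s → s ≤ t → η₂ s ≤ η₂ t := fun s t hs hst =>
    hge₂ t _ fun α β h => (hleast s α β hs (h.subset (Icc_subset_Icc_right hst))).2.trans
      (h.mono_right ⟨hs, hst⟩ ⟨hs.trans hst, le_rfl⟩ hst)
  have l₁ : ∀ t, 0 ≤ t → a - ψ t + η₂ t ≤ η₁ t := fun t ht =>
    hge₁ t _ fun α β h => by
      linarith [h.lower t ⟨ht, le_rfl⟩, (hleast t α β ht h).2]
  have l₂ : ∀ t, 0 ≤ t → ψ t - b + η₁ t ≤ η₂ t := fun t ht =>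
    hge₂ t _ fun α β h => by
      linarith [h.upper t ⟨ht, le_rfl⟩, (hleast t α β ht h).1]
  refine ⟨η₁, η₂, ⟨p₁, fun s t hs hst => (l₁ s hs).trans (m₁ s t hs hst), ?_⟩,
    ⟨p₂, fun s t hs hst => ?_, ?_⟩⟩
  · intro t c ht hc hct
    by_contra! hcon
    have hconf : IsConfining a b ψ (Icc 0 t) (fun u => min (η₁ u) c) η₂ := by
      refine ⟨fun u hu => le_min (p₁ u hu.1) hc, fun u hu => p₂ u hu.1,
        fun u hu v hv huv => min_le_min_right c (m₁ u v hu.1 huv),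
        fun u hu v hv huv => m₂ u v hu.1 huv, fun u hu => ?_, fun u hu => ?_,
        max c (η₂ t), fun u hu => ⟨(min_le_right _ _).trans (le_max_left _ _),
          (m₂ u t hu.1 hu.2).trans (le_max_right _ _)⟩⟩
      · have := le_min (l₁ u hu.1) (hcon u hu.1 hu.2)
        linarith
      · linarith [l₂ u hu.1, min_le_left (η₁ u) c]
    exact absurd ((hleast t _ _ ht hconf).1.trans (min_le_right _ _)) (not_le.2 hct)
  · simp only [Pi.neg_apply]
    linarith [l₂ s hs, m₂ s t hs hst]
  · intro t c ht hc hct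
    by_contra! hcon
    simp only [Pi.neg_apply] at hcon
    have hconf : IsConfining a b ψ (Icc 0 t) η₁ (fun u => min (η₂ u) c) := by
      refine ⟨fun u hu => p₁ u hu.1, fun u hu => le_min (p₂ u hu.1) hc,
        fun u hu v hv huv => m₁ u v hu.1 huv,
        fun u hu v hv huv => min_le_min_right c (m₂ u v hu.1 huv), fun u hu => ?_,
        fun u hu => ?_, max c (η₁ t), fun u hu => ⟨(m₁ u t hu.1 hu.2).trans (le_max_right _ _),
          (min_le_right _ _).trans (le_max_left _ _)⟩⟩
      · linarith [l₁ u hu.1, min_le_left (η₂ u) c]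
      · have := le_min (l₂ u hu.1) (by linarith [hcon u hu.1 hu.2] : ψ u - b + η₁ u ≤ c)
        linarith
    exact absurd ((hleast t _ _ ht hconf).2.trans (min_le_right _ _)) (not_le.2 hct)

/-- Boundary terms depend monotonically on the process subtracted from the input. -/
theorem IsReflectionTerm.le_of_le {a : ℝ} {ψ ζ η ζ' η' : ℝ → ℝ} (h : IsReflectionTerm a ψ ζ η)
    (h' : IsReflectionTerm a ψ ζ' η') {t : ℝ} (ht : 0 ≤ t)
    (hζ : ∀ s, 0 ≤ s → s ≤ t → ζ' s ≤ ζ s) : η' t ≤ η t := by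
  by_contra! hlt
  obtain ⟨s, hs, hst, hs'⟩ := h'.exists_lt t _ ht (h.nonneg t ht) hlt
  linarith [h.le s t hs hst, hζ s hs hst]

/-- If the reflected path stays away from the barrier from time `τ` on, then its boundary term is
dominated by any other one whose subtracted process dominates its own before `τ`. -/
theorem IsReflectionTerm.le_of_away {a : ℝ} {ψ ζ η ζ' η' : ℝ → ℝ}
    (h : IsReflectionTerm a ψ ζ η) (h' : IsReflectionTerm a ψ ζ' η') {τ t ε : ℝ}
    (ht : 0 ≤ t) (hε : 0 < ε) (hζ : ∀ s, 0 ≤ s → s < τ → ζ' s ≤ ζ s)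
    (haway : ∀ s, 0 ≤ s → τ ≤ s → s ≤ t → a + ε ≤ ψ s + η' s - ζ' s) : η' t ≤ η t := by
  by_contra! hlt
  obtain ⟨s, hs, hst, hs'⟩ := h'.exists_lt t (max (η t) (η' t - ε)) ht
    ((h.nonneg t ht).trans (le_max_left _ _)) (max_lt hlt (by linarith))
  have e₁ := (le_max_left _ _).trans_lt hs'
  have e₂ := (le_max_right _ _).trans_lt hs'
  rcases lt_or_ge s τ with hsτ | hsτ
  · linarith [h.le s t hs hst, hζ s hs hsτ]
  · linarith [haway s hs hsτ hst, h'.mono hs hst]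

theorem IsReflectionTerm.le_of_isReflectionTerm {a b : ℝ} (hab : a < b) {ψ η₁ η₂ η₁' η₂' : ℝ → ℝ}
    (hψ : ∀ t : ℝ, 0 ≤ t → ContinuousWithinAt ψ (Ici t) t)
    (h₁ : IsReflectionTerm a ψ η₂ η₁) (h₂ : IsReflectionTerm (-b) (-ψ) η₁ η₂)
    (h₁' : IsReflectionTerm a ψ η₂' η₁') (h₂' : IsReflectionTerm (-b) (-ψ) η₁' η₂') (t : ℝ)
    (ht : 0 ≤ t) : η₁' t ≤ η₁ t ∧ η₂' t ≤ η₂ t := by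
  by_contra hcon
  set U : Set ℝ := {u | 0 ≤ u ∧ ¬(η₁' u ≤ η₁ u ∧ η₂' u ≤ η₂ u)}
  have hUb : BddBelow U := ⟨0, fun u hu => hu.1⟩
  have hUt : t ∈ U := ⟨ht, hcon⟩
  set τ := sInf U
  have hτ0 : 0 ≤ τ := le_csInf ⟨t, hUt⟩ fun u hu => hu.1
  have hbefore : ∀ s, 0 ≤ s → s < τ → η₁' s ≤ η₁ s ∧ η₂' s ≤ η₂ s := fun s hs hsτ => by
    by_contra hc
    exact absurd (csInf_le hUb ⟨hs, hc⟩) (not_le.2 hsτ)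
  have hc := h₁'.rightContinuous hab h₂' hτ0 (hψ τ hτ0)
  have hφ := ((hψ τ hτ0).add hc.1).sub hc.2
  obtain ⟨δ, hδ, H⟩ := Metric.continuousWithinAt_iff.1 hφ ((b - a) / 4) (by linarith)
  obtain ⟨u, hu, huδ⟩ := exists_lt_of_csInf_lt ⟨t, hUt⟩ (show τ < τ + δ by linarith)
  have hnear : ∀ s, τ ≤ s → s ≤ u →
      |ψ s + η₁' s - η₂' s - (ψ τ + η₁' τ - η₂' τ)| < (b - a) / 4 := by
    intro s hs hsu
    exact H (mem_Ici.2 hs) (by rw [Real.dist_eq, abs_of_nonneg (by linarith)]; linarith)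
  apply hu.2
  rcases le_total ((a + b) / 2) (ψ τ + η₁' τ - η₂' τ) with hmid | hmid
  · have e₁ : ∀ v, 0 ≤ v → v ≤ u → η₁' v ≤ η₁ v := fun v hv hvu =>
      h₁.le_of_away h₁' (ε := (b - a) / 4) hv (by linarith) (fun s hs hsτ => (hbefore s hs hsτ).2)
        fun s _ hτs hsv => by linarith [(abs_lt.1 (hnear s hτs (hsv.trans hvu))).1]
    exact ⟨e₁ u hu.1 le_rfl, h₂.le_of_le h₂' hu.1 e₁⟩
  · have e₂ : ∀ v, 0 ≤ v → v ≤ u → η₂' v ≤ η₂ v := fun v hv hvu =>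
      h₂.le_of_away h₂' (ε := (b - a) / 4) hv (by linarith) (fun s hs hsτ => (hbefore s hs hsτ).1)
        fun s _ hτs hsv => by
          simp only [Pi.neg_apply]
          linarith [(abs_lt.1 (hnear s hτs (hsv.trans hvu))).2]
    exact ⟨h₁.le_of_le h₁' hu.1 e₂, e₂ u hu.1 le_rfl⟩

/-- Existence and uniqueness for the two-sided Skorohod problem on `[a,b]` with a
càdlàg input `ψ : [0,∞) → ℝ` (right-continuous with left limits). -/
theorem skorohod_problem_exists_unique (a b : ℝ) (hab : a < b) (ψ : ℝ → ℝ)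
    (hψrc : ∀ t : ℝ, 0 ≤ t → ContinuousWithinAt ψ (Set.Ici t) t)
    (hψll : ∀ t : ℝ, 0 < t →
      ∃ c : ℝ, Filter.Tendsto ψ (nhdsWithin t (Set.Iio t)) (nhds c)) :
    ∃ φ η₁ η₂ : ℝ → ℝ, IsSkorohodSolution a b ψ φ η₁ η₂ ∧
      ∀ φ' η₁' η₂' : ℝ → ℝ, IsSkorohodSolution a b ψ φ' η₁' η₂' →
        ∀ t : ℝ, 0 ≤ t → φ t = φ' t ∧ η₁ t = η₁' t ∧ η₂ t = η₂' t := by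
  obtain ⟨η₁, η₂, h₁, h₂⟩ :=
    exists_isReflectionTerm (IsConfining.exists_Icc hab hψrc hψll)
  refine ⟨fun t => ψ t + η₁ t - η₂ t, η₁, η₂,
    (isSkorohodSolution_iff hab hψrc).2 ⟨fun _ _ => rfl, h₁, h₂⟩, ?_⟩
  intro φ' η₁' η₂' h' t ht
  obtain ⟨hφ', h₁', h₂'⟩ := (isSkorohodSolution_iff hab hψrc).1 h'
  have hle := IsReflectionTerm.le_of_isReflectionTerm hab hψrc h₁ h₂ h₁' h₂' t ht
  have hge := IsReflectionTerm.le_of_isReflectionTerm hab hψrc h₁' h₂' h₁ h₂ t ht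
  have e₁ := le_antisymm hge.1 hle.1
  have e₂ := le_antisymm hge.2 hle.2
  exact ⟨by simp only [hφ' t ht, e₁, e₂], e₁, e₂⟩
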